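/- arXiv:1901.02135 — 2 statements merged into one kernel-verified Lean document; each statement's English description precedes it below -/
import Mathlib

section
/- Let (X,d) be a compact metric space, φ a continuous flow on X without fixed points, and μ an ergodic φ-invariant Borel probability measure. Then h_top^B(φ, G_μ(φ)) ≤ h_μ(φ₁), i.e. the Bowen entropy of the set of generic points of μ is bounded above by the measure-theoretic entropy of the time-one map. -/
open MeasureTheory Filter Set Topology
open scoped ENNReal NNReal

namespace FlowEntropy

variable {X : Type*}

/-- A continuous flow on `X`. -/
structure IsFlow [TopologicalSpace X] (φ : ℝ → X → X) : Prop where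
  cont : Continuous fun p : ℝ × X => φ p.1 p.2
  map_zero : ∀ x, φ 0 x = x
  map_add : ∀ s t : ℝ, ∀ x, φ (s + t) x = φ s (φ t x)

/-- The flow has no fixed points. -/
def FixedPointFree (φ : ℝ → X → X) : Prop :=
  ∀ x : X, ∃ t : ℝ, φ t x ≠ x

/-- The measure `μ` is invariant under every time-`t` map of the flow. -/
def FlowInvariant [MeasurableSpace X] (φ : ℝ → X → X) (μ : Measure X) : Prop :=
  ∀ t : ℝ, MeasurePreserving (φ t) μ μ

/-- The measure `μ` is invariant and ergodic for the flow: every Borel set invariant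
under all time-`t` maps has measure `0` or `1`. -/
def FlowErgodic [MeasurableSpace X] (φ : ℝ → X → X) (μ : Measure X) : Prop :=
  FlowInvariant φ μ ∧
    ∀ B : Set X, MeasurableSet B → (∀ t : ℝ, φ t ⁻¹' B = B) → μ B = 0 ∨ μ B = 1

/-- `α` is a reparametrization on the closed interval `I` (containing the origin):
a continuous map that is a homeomorphism onto its image (equivalently, continuous and
injective on the compact interval), fixing the origin. -/
def IsReparOn (α : ℝ → ℝ) (I : Set ℝ) : Prop :=
  ContinuousOn α I ∧ Set.InjOn α I ∧ α 0 = 0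

/-- The reparametrization ball `B(x, t, ε, φ)`. -/
def reparBall [PseudoMetricSpace X] (φ : ℝ → X → X) (x : X) (t ε : ℝ) : Set X :=
  {y : X | ∃ α : ℝ → ℝ, IsReparOn α (Set.Icc 0 t) ∧
      ∀ s ∈ Set.Icc (0 : ℝ) t, dist (φ (α s) x) (φ s y) < ε}

/-- `M^s_{N,ε}(φ, Z)`: infimum of `Σ_i exp (-s t_i)` over countable families of
reparametrization balls `B(x_i, t_i, ε, φ)` with `t_i ≥ N` covering `Z`. -/
noncomputable def coverM [PseudoMetricSpace X] (φ : ℝ → X → X) (Z : Set X) (s : ℝ) (N : ℕ)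
    (ε : ℝ) : ℝ≥0∞ :=
  ⨅ (F : Set (X × ℝ)) (_ : F.Countable) (_ : ∀ p ∈ F, (N : ℝ) ≤ p.2)
    (_ : Z ⊆ ⋃ p ∈ F, reparBall φ p.1 p.2 ε),
    ∑' p : F, ENNReal.ofReal (Real.exp (-s * (p : X × ℝ).2))

/-- `M^s_ε(φ, Z) = lim_{N → ∞} M^s_{N,ε}(φ, Z)` (an increasing limit). -/
noncomputable def coverMeps [PseudoMetricSpace X] (φ : ℝ → X → X) (Z : Set X) (s ε : ℝ) :
    ℝ≥0∞ :=
  ⨆ N : ℕ, coverM φ Z s N ε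

/-- `M^s(φ, Z) = lim_{ε → 0} M^s_ε(φ, Z)` (an increasing limit as `ε` decreases). -/
noncomputable def coverMlim [PseudoMetricSpace X] (φ : ℝ → X → X) (Z : Set X) (s : ℝ) :
    ℝ≥0∞ :=
  ⨆ (ε : ℝ) (_ : 0 < ε), coverMeps φ Z s ε

/-- The Bowen entropy `h_top^B(φ, Z)`: the critical value where `M^s(φ,Z)` jumps
from `∞` to `0` (as an extended nonnegative real; `⊤` if no finite critical value). -/
noncomputable def bowenEntropy [PseudoMetricSpace X] (φ : ℝ → X → X) (Z : Set X) : ℝ≥0∞ :=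
  ⨅ (s : ℝ) (_ : 0 ≤ s) (_ : coverMlim φ Z s = 0), ENNReal.ofReal s

/-- Static entropy of a finite measurable partition, encoded as a map into a finite type. -/
noncomputable def partEnt [MeasurableSpace X] (μ : Measure X) {ι : Type*} [Fintype ι]
    (P : X → ι) : ℝ :=
  ∑ i : ι, Real.negMulLog ((μ (P ⁻¹' {i})).toReal)

/-- The measure-theoretic (Kolmogorov–Sinai) entropy of a map `T` with respect to `μ`:
the supremum over finite measurable partitions of the asymptotic entropy per unit time of
the dynamical refinements. -/
noncomputable def kolSinai [MeasurableSpace X] (μ : Measure X) (T : X → X) : ℝ≥0∞ :=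
  ⨆ (k : ℕ) (P : X → Fin k) (_ : Measurable P),
    Filter.limsup (fun n : ℕ =>
      ENNReal.ofReal (partEnt μ (fun x => fun j : Fin n => P (T^[(j : ℕ)] x)) / n))
      Filter.atTop

/-- `-log a` as a member of `ℝ≥0∞`, for `a ∈ [0,1]` (with `-log 0 = ∞`). -/
noncomputable def negLogNN (a : ℝ≥0∞) : ℝ≥0∞ :=
  if a = 0 then ⊤ else ENNReal.ofReal (-Real.log a.toReal)

/-- `-(1/t) log μ(B(x,t,ε,φ))`, as a member of `ℝ≥0∞`. -/
noncomputable def localRate [PseudoMetricSpace X] [MeasurableSpace X] (μ : Measure X)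
    (φ : ℝ → X → X) (x : X) (ε t : ℝ) : ℝ≥0∞ :=
  negLogNN (μ (reparBall φ x t ε)) / ENNReal.ofReal t

/-- The lower local entropy `underline h_μ(φ, x) = lim_{ε→0} liminf_{t→∞}
  -(1/t) log μ(B(x,t,ε,φ))` (the limit in `ε` is an increasing limit, hence a supremum). -/
noncomputable def lowerLocalEnt [PseudoMetricSpace X] [MeasurableSpace X] (μ : Measure X)
    (φ : ℝ → X → X) (x : X) : ℝ≥0∞ :=
  ⨆ (ε : ℝ) (_ : 0 < ε), Filter.liminf (fun t : ℝ => localRate μ φ x ε t) Filter.atTop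

/-- The upper local entropy `overline h_μ(φ, x) = lim_{ε→0} limsup_{t→∞}
  -(1/t) log μ(B(x,t,ε,φ))`. -/
noncomputable def upperLocalEnt [PseudoMetricSpace X] [MeasurableSpace X] (μ : Measure X)
    (φ : ℝ → X → X) (x : X) : ℝ≥0∞ :=
  ⨆ (ε : ℝ) (_ : 0 < ε), Filter.limsup (fun t : ℝ => localRate μ φ x ε t) Filter.atTop

/-- The set `G_μ(φ)` of generic points of `μ` for the flow `φ`. -/
def genericPts [TopologicalSpace X] [MeasurableSpace X] (φ : ℝ → X → X) (μ : Measure X) :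
    Set X :=
  {x : X | ∀ f : C(X, ℝ),
    Filter.Tendsto (fun t : ℝ => (1 / t) * ∫ τ in (0 : ℝ)..t, f (φ τ x))
      Filter.atTop (nhds (∫ y, f y ∂μ))}

lemma IsFlow.iterate_one [TopologicalSpace X] {φ : ℝ → X → X} (hφ : IsFlow φ) (j : ℕ) (x : X) :
    (φ 1)^[j] x = φ j x := by
  induction j with
  | zero => simp [hφ.map_zero]
  | succ j ih =>
    rw [Function.iterate_succ_apply', ih, ← hφ.map_add]
    push_cast
    rw [add_comm]

/-- Joint uniform continuity of a flow on a compact space for times in `[-1, 1]`. -/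
lemma IsFlow.exists_dist_lt [PseudoMetricSpace X] [CompactSpace X] {φ : ℝ → X → X}
    (hφ : IsFlow φ) {ε : ℝ} (hε : 0 < ε) :
    ∃ η > 0, ∀ x y : X, ∀ s ∈ Icc (-1 : ℝ) 1, ∀ t ∈ Icc (-1 : ℝ) 1,
      dist s t < η → dist x y < η → dist (φ s x) (φ t y) < ε := by
  have hcont : Continuous fun p : Icc (-1 : ℝ) 1 × X => φ p.1 p.2 :=
    hφ.cont.comp (by fun_prop : Continuous fun p : Icc (-1 : ℝ) 1 × X => ((p.1 : ℝ), p.2))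
  obtain ⟨η, hη, h⟩ :=
    Metric.uniformContinuous_iff.1 (CompactSpace.uniformContinuous_of_continuous hcont) ε hε
  refine ⟨η, hη, fun x y s hs t ht hst hxy => ?_⟩
  exact h (a := (⟨s, hs⟩, x)) (b := (⟨t, ht⟩, y)) (max_lt hst hxy)

/-- A finite measurable partition into sets of small diameter whose boundaries are null. -/
lemma exists_small_partition [PseudoMetricSpace X] [CompactSpace X] [MeasurableSpace X]
    [BorelSpace X] (μ : Measure X) [SFinite μ] {η : ℝ} (hη : 0 < η) :
    ∃ (k : ℕ) (P : X → Fin k), Measurable P ∧ (∀ᵐ x ∂μ, ContinuousAt P x) ∧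
      ∀ x y, P x = P y → dist x y < η := by
  classical
  choose r hr hr0 using fun x : X =>
    exists_null_frontier_thickening μ ({x} : Set X) (show η / 4 < η / 2 by linarith)
  simp only [Metric.thickening_singleton] at hr0
  obtain ⟨t, -, ht⟩ := isCompact_univ.elim_nhds_subcover (fun x : X => Metric.ball x (r x))
    (fun x _ => Metric.ball_mem_nhds x ((by linarith : 0 < η / 4).trans (hr x).1))
  let e := Fintype.equivFin (t → Bool)
  let R : X → t → Bool := fun x i => decide (x ∈ Metric.ball i.1 (r i))
  have hR : Measurable R := by
    refine measurable_pi_lambda _ fun i => measurable_to_bool ?_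
    have : (fun x => R x i) ⁻¹' {true} = Metric.ball i.1 (r i) := by ext x; simp [R]
    rw [this]
    exact Metric.isOpen_ball.measurableSet
  refine ⟨_, fun x => e (R x), (measurable_of_finite e).comp hR, ?_, fun x y hxy => ?_⟩
  · have hnull : ∀ᵐ x ∂μ, ∀ i : t, x ∉ frontier (Metric.ball i.1 (r i)) :=
      ae_all_iff.2 fun i => measure_eq_zero_iff_ae_notMem.1 (hr0 i)
    filter_upwards [hnull] with x hx
    refine (continuous_of_discreteTopology (f := e)).continuousAt.comp ?_
    refine continuousAt_pi.2 fun i => ?_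
    by_cases hxi : x ∈ Metric.ball i.1 (r i)
    · refine (continuousAt_const (y := true)).congr ?_
      filter_upwards [Metric.isOpen_ball.mem_nhds hxi] with y hy
      exact (decide_eq_true hy).symm
    · have hxc : x ∈ (closure (Metric.ball i.1 (r i)))ᶜ := fun hcl =>
        hx i ⟨hcl, fun hint => hxi (interior_subset hint)⟩
      refine (continuousAt_const (y := false)).congr ?_
      filter_upwards [isClosed_closure.isOpen_compl.mem_nhds hxc] with y hy
      exact (decide_eq_false fun h => hy (subset_closure h)).symm
  · obtain ⟨z, hz, hxz⟩ := mem_iUnion₂.1 (ht (mem_univ x))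
    have hRxy : R x = R y := e.injective hxy
    have hyz : y ∈ Metric.ball z (r z) := by
      have := congrFun hRxy ⟨z, hz⟩
      simpa [R, Metric.mem_ball.1 hxz] using this
    have h1 := Metric.mem_ball.1 hxz
    have h2 := Metric.mem_ball'.1 hyz
    linarith [dist_triangle x z y, (hr z).2]

/-- Any probability vector of entropy less than `c` can be replaced by positive weights of total
mass at most one with cross entropy less than `c`. -/
lemma exists_pos_weights {W : Type*} [Fintype W] (q : W → ℝ) (hq : ∀ w, 0 ≤ q w)
    (hq1 : ∑ w, q w = 1) {c : ℝ} (hc : ∑ w, Real.negMulLog (q w) < c) :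
    ∃ p : W → ℝ, (∀ w, 0 < p w) ∧ ∑ w, p w ≤ 1 ∧ ∑ w, q w * -Real.log (p w) < c := by
  set M : ℝ := (Fintype.card W : ℝ) with hM
  have htend : Tendsto (fun η : ℝ => ∑ w, q w * -Real.log ((q w + η) / (1 + M * η)))
      (𝓝[>] 0) (𝓝 (∑ w, Real.negMulLog (q w))) := by
    refine tendsto_finsetSum _ fun w _ => ?_
    rcases (hq w).eq_or_lt with h0 | h0
    · simp [← h0]
    · have : ContinuousAt (fun η : ℝ => q w * -Real.log ((q w + η) / (1 + M * η))) 0 := by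
        refine continuousAt_const.mul (ContinuousAt.neg (ContinuousAt.log ?_ ?_))
        · refine ContinuousAt.div (by fun_prop) (by fun_prop) (by simp)
        · simpa using h0.ne'
      have h1 := this.tendsto.mono_left (nhdsWithin_le_nhds (s := Ioi 0))
      simpa [Real.negMulLog] using h1
  obtain ⟨η, hη, hη0⟩ := ((htend.eventually_lt_const hc).and self_mem_nhdsWithin).exists
  have hη0 : 0 < η := hη0
  have hM0 : 0 ≤ M := Nat.cast_nonneg _
  have hden : 0 < 1 + M * η := by positivity
  refine ⟨fun w => (q w + η) / (1 + M * η), fun w => ?_, ?_, hη⟩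
  · have := hq w
    positivity
  · rw [← Finset.sum_div, Finset.sum_add_distrib, hq1]
    simp [← hM, div_self hden.ne']

/-- A nonnegative simple function whose discontinuity set is null admits continuous majorants
with almost the same integral. -/
lemma exists_continuous_majorant [PseudoMetricSpace X] [CompactSpace X] [MeasurableSpace X]
    [BorelSpace X] (μ : Measure X) [IsFiniteMeasure μ] {W : Type*} [Fintype W]
    [TopologicalSpace W] [DiscreteTopology W] (Q : X → W) (hQ : ∀ᵐ x ∂μ, ContinuousAt Q x)
    (g : W → ℝ) (hg : ∀ w, 0 ≤ g w) {c : ℝ} (hc : ∑ w, μ.real (Q ⁻¹' {w}) * g w < c) :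
    ∃ f : C(X, ℝ), (∀ x, g (Q x) ≤ f x) ∧ ∫ x, f x ∂μ < c := by
  have hclosure : ∀ w, μ.real (closure (Q ⁻¹' {w})) = μ.real (Q ⁻¹' {w}) := by
    intro w
    refine measureReal_congr ?_
    filter_upwards [hQ] with x hx
    refine propext ⟨fun hmem => ?_, fun hmem => subset_closure hmem⟩
    have hU : Q ⁻¹' {Q x} ∈ 𝓝 x := hx (by simp)
    obtain ⟨y, hy1, hy2⟩ := mem_closure_iff_nhds.1 hmem _ hU
    exact (hy1 : Q y = Q x).symm.trans hy2
  have hδ : ∀ n : ℕ, (0 : ℝ) < 1 / ((n : ℝ) + 1) := fun n => Nat.one_div_pos_of_nat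
  let F : ℕ → W → BoundedContinuousFunction X ℝ≥0 := fun n w =>
    thickenedIndicator (hδ n) (closure (Q ⁻¹' {w}))
  have htend : Tendsto (fun n => ∑ w, (∫ x, (F n w x : ℝ) ∂μ) * g w) atTop
      (𝓝 (∑ w, μ.real (Q ⁻¹' {w}) * g w)) := by
    refine tendsto_finsetSum _ fun w _ => Tendsto.mul_const _ ?_
    rw [← hclosure w]
    exact tendsto_integral_thickenedIndicator_of_isClosed μ isClosed_closure hδ
      tendsto_one_div_add_atTop_nhds_zero_nat
  obtain ⟨n, hn⟩ := (htend.eventually_lt_const hc).exists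
  have hcont : ∀ w, Continuous fun x => (F n w x : ℝ) := fun w =>
    NNReal.continuous_coe.comp (F n w).continuous
  refine ⟨⟨fun x => ∑ w, (F n w x : ℝ) * g w, by fun_prop⟩, fun x => ?_, ?_⟩
  · have h1 : F n (Q x) x = 1 :=
      thickenedIndicator_one (hδ n) _ (subset_closure (by simp))
    calc g (Q x) = (F n (Q x) x : ℝ) * g (Q x) := by simp [h1]
      _ ≤ ∑ w, (F n w x : ℝ) * g w :=
        Finset.single_le_sum (f := fun w => (F n w x : ℝ) * g w)
          (fun w _ => mul_nonneg (NNReal.coe_nonneg _) (hg w)) (Finset.mem_univ _)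
  · rw [ContinuousMap.coe_mk, integral_finsetSum]
    · simpa only [integral_mul_const] using hn
    · exact fun w _ => (integrable_thickenedIndicator _ (hδ n)).mul_const _

/-- The number of words of length `n` of weight at least `exp (-n c)` is at most `exp (n c)`. -/
lemma card_words_le {W : Type*} [Fintype W] (p : W → ℝ) (hp : ∀ w, 0 < p w)
    (hp1 : ∑ w, p w ≤ 1) (c : ℝ) (n : ℕ) :
    (Nat.card {v : Fin n → W // ∑ i, -Real.log (p (v i)) ≤ n * c} : ℝ) ≤ Real.exp (n * c) := by
  classical
  rw [Nat.card_eq_fintype_card, Fintype.card_subtype]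
  set S := Finset.univ.filter fun v : Fin n → W => ∑ i, -Real.log (p (v i)) ≤ n * c with hS
  have hlow : ∀ v ∈ S, Real.exp (-(n * c)) ≤ ∏ i, p (v i) := by
    intro v hv
    have hv : ∑ i, -Real.log (p (v i)) ≤ n * c := by simpa [hS] using hv
    rw [Finset.sum_neg_distrib] at hv
    calc Real.exp (-(n * c)) ≤ Real.exp (∑ i, Real.log (p (v i))) :=
          Real.exp_le_exp.2 (by linarith)
      _ = ∏ i, p (v i) := by
          rw [Real.exp_sum]
          exact Finset.prod_congr rfl fun i _ => Real.exp_log (hp _)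
  have hsum : (S.card : ℝ) * Real.exp (-(n * c)) ≤ 1 := by
    calc (S.card : ℝ) * Real.exp (-(n * c)) ≤ ∑ v ∈ S, ∏ i, p (v i) := by
          simpa using Finset.card_nsmul_le_sum S _ _ hlow
      _ ≤ ∑ v : Fin n → W, ∏ i, p (v i) :=
          Finset.sum_le_sum_of_subset_of_nonneg (Finset.subset_univ _)
            fun v _ _ => Finset.prod_nonneg fun i _ => (hp _).le
      _ = (∑ w, p w) ^ n := by
          simpa using (Finset.sum_pow' Finset.univ p n).symm
      _ ≤ 1 := pow_le_one₀ (Finset.sum_nonneg fun w _ => (hp w).le) hp1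
  rwa [Real.exp_neg, ← div_eq_mul_inv, div_le_one (Real.exp_pos _)] at hsum

/-- If the average of `f` over `[0, n m]` is less than `a`, then along some arithmetic progression
of step `m` the average is less than `a`. -/
lemma exists_offset {f : ℝ → ℝ} (hf : Continuous f) {m a : ℝ} (hm : 0 < m) {n : ℕ}
    (h : ∫ τ in (0 : ℝ)..n * m, f τ < n * m * a) :
    ∃ u ∈ Icc 0 m, ∑ i : Fin n, f (i * m + u) < n * a := by
  by_contra! hcon
  have hsplit : ∫ τ in (0 : ℝ)..n * m, f τ = ∫ u in (0 : ℝ)..m, ∑ i : Fin n, f (i * m + u) := by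
    rw [intervalIntegral.integral_finsetSum
      fun (i : Fin n) _ => (by fun_prop : Continuous fun u => f (i * m + u)).intervalIntegrable _ _]
    have h1 := intervalIntegral.sum_integral_adjacent_intervals (f := f) (μ := volume)
      (a := fun i : ℕ => i * m) (n := n) fun i _ => hf.intervalIntegrable _ _
    simp only [Nat.cast_zero, zero_mul] at h1
    rw [← h1, ← Fin.sum_univ_eq_sum_range (fun i => ∫ τ in (i * m : ℝ)..((i + 1 : ℕ) * m), f τ)]
    refine Finset.sum_congr rfl fun i _ => ?_
    rw [intervalIntegral.integral_comp_add_left]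
    congr 1 <;> push_cast <;> ring
  have hle : ∫ _u in (0 : ℝ)..m, n * a ≤ ∫ u in (0 : ℝ)..m, ∑ i : Fin n, f (i * m + u) := by
    refine intervalIntegral.integral_mono_on hm.le (by simp) ?_ hcon
    exact Continuous.intervalIntegrable (by fun_prop) _ _
  rw [← hsplit, intervalIntegral.integral_const, smul_eq_mul] at hle
  linarith [hle, show (m - 0) * (n * a) = n * m * a by ring]

lemma exists_nat_sub_mem_Icc {r : ℝ} {n : ℕ} (hr : 0 ≤ r) (hrn : r ≤ n) (hn : 0 < n) :
    ∃ j < n, r - j ∈ Icc (0 : ℝ) 1 := by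
  rcases hrn.lt_or_eq with h | rfl
  · exact ⟨⌊r⌋₊, (Nat.floor_lt hr).2 h, by linarith [Nat.floor_le hr],
      by linarith [Nat.lt_floor_add_one r]⟩
  · refine ⟨n - 1, by omega, ?_⟩
    rw [Nat.cast_pred hn]
    constructor <;> linarith

/-- Orbits with the same coarse names, read from nearby offsets, stay close. -/
lemma dist_orbit_lt [PseudoMetricSpace X] {φ : ℝ → X → X} (hφ : IsFlow φ) {ι : Type*}
    {P : X → ι} {ε δ : ℝ}
    (hP : ∀ x y, P x = P y → ∀ s ∈ Icc (0 : ℝ) 1, dist (φ s x) (φ s y) < ε / 2)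
    (hδ : ∀ (r : ℝ) (z : X), |r| ≤ δ → dist (φ r z) z < ε / 2)
    {m n : ℕ} {x y : X} {u v : ℝ} (hu : u ∈ Icc (0 : ℝ) m) (huv : |v - u| ≤ δ)
    (hstart : ∀ j < m + 1, P (φ j x) = P (φ j y))
    (hname : ∀ j < n, P (φ (j + u) x) = P (φ (j + v) y))
    {s : ℝ} (hs : s ∈ Icc (0 : ℝ) n) : dist (φ s x) (φ s y) < ε := by
  have hεpos : 0 < ε := by
    have := dist_nonneg.trans_lt (hδ (v - u) x huv)
    linarith
  rcases le_or_gt s m with hsm | hsm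
  · obtain ⟨j, hj, hsj⟩ := exists_nat_sub_mem_Icc hs.1
      (hsm.trans (Nat.cast_le.2 m.le_succ)) m.succ_pos
    have h1 := hP _ _ (hstart j hj) _ hsj
    rw [← hφ.map_add, ← hφ.map_add, sub_add_cancel] at h1
    linarith
  · have hn : 0 < n := by
      have : (0 : ℝ) < n := (Nat.cast_nonneg m).trans_lt (hsm.trans_le hs.2)
      exact_mod_cast this
    obtain ⟨j, hj, hsj⟩ := exists_nat_sub_mem_Icc (r := s - u) (by linarith [hu.2])
      (by linarith [hu.1, hs.2]) hn
    have h1 := hP _ _ (hname j hj) _ hsj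
    rw [← hφ.map_add, ← hφ.map_add, show s - u - j + (j + u) = s by ring,
      show s - u - j + (j + v) = (v - u) + s by ring, hφ.map_add] at h1
    linarith [dist_triangle (φ s x) (φ (v - u) (φ s y)) (φ s y), hδ (v - u) (φ s y) huv]

/-- Points sharing a code lie in each other's sets, so one set per code suffices to cover. -/
lemma exists_cover_of_code [Nonempty X] {C : Type*} (Z : Set X) (B : X → Set X)
    (R : X → C → Prop) (hR : ∀ x ∈ Z, ∃ c, R x c) (hB : ∀ x y c, R x c → R y c → y ∈ B x) :
    ∃ z : C → X, Z ⊆ ⋃ c, B (z c) := by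
  classical
  refine ⟨fun c => Classical.epsilon fun x => R x c, fun y hy => ?_⟩
  obtain ⟨c, hc⟩ := hR y hy
  exact mem_iUnion.2 ⟨c, hB _ _ c (Classical.epsilon_spec (p := fun x => R x c) ⟨y, hc⟩) hc⟩

lemma mem_reparBall_of_forall_dist_lt [PseudoMetricSpace X] {φ : ℝ → X → X} {x y : X} {t ε : ℝ}
    (h : ∀ s ∈ Icc (0 : ℝ) t, dist (φ s x) (φ s y) < ε) : y ∈ reparBall φ x t ε :=
  ⟨id, ⟨continuousOn_id, injOn_id _, rfl⟩, h⟩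

lemma coverM_le_tsum [PseudoMetricSpace X] (φ : ℝ → X → X) (Z : Set X) (s : ℝ) (N : ℕ) (ε : ℝ)
    {ι : Type*} [Countable ι] (z : ι → X) (t : ι → ℝ) (ht : ∀ i, (N : ℝ) ≤ t i)
    (hZ : Z ⊆ ⋃ i, reparBall φ (z i) (t i) ε) :
    coverM φ Z s N ε ≤ ∑' i, ENNReal.ofReal (Real.exp (-s * t i)) := by
  let F : ι → X × ℝ := fun i => (z i, t i)
  refine (iInf₂_le_of_le (range F) (countable_range F) <| iInf₂_le_of_le
    (by rintro _ ⟨i, rfl⟩; exact ht i) (by simpa [F, biUnion_range] using hZ) le_rfl).trans ?_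
  have h := ENNReal.tsum_comp_le_tsum_of_injective
    (rangeSplitting_injective F) fun i => ENNReal.ofReal (Real.exp (-s * t i))
  refine le_trans (le_of_eq (tsum_congr fun p => ?_)) h
  have hp : t (rangeSplitting F p) = (p : X × ℝ).2 :=
    congrArg Prod.snd (apply_rangeSplitting F p)
  rw [hp]

/-- The points that, at some offset in `[0, m]`, have a name of large weight at scale `n` are
covered by few reparametrization balls of length `n m`. -/
lemma exists_reparBall_cover [PseudoMetricSpace X] [Nonempty X] {φ : ℝ → X → X}
    (hφ : IsFlow φ) {k : ℕ} {P : X → Fin k} {ε δ : ℝ} (hδ0 : 0 < δ)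
    (hP : ∀ x y, P x = P y → ∀ s ∈ Icc (0 : ℝ) 1, dist (φ s x) (φ s y) < ε / 2)
    (hδ : ∀ (r : ℝ) (z : X), |r| ≤ δ → dist (φ r z) z < ε / 2) (m : ℕ) :
    ∃ K : ℕ, ∀ (p : (Fin m → Fin k) → ℝ) (c : ℝ), (∀ w, 0 < p w) → ∑ w, p w ≤ 1 →
      ∀ n : ℕ, ∃ (L : ℕ) (z : Fin L → X), (L : ℝ) ≤ K * Real.exp (n * c) ∧
        {x | ∃ u ∈ Icc (0 : ℝ) m,
          ∑ i : Fin n, -Real.log (p fun j => P (φ j (φ (i * m + u) x))) ≤ n * c} ⊆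
          ⋃ i, reparBall φ (z i) (n * m) ε := by
  classical
  let D := Fin (⌊m / δ⌋₊ + 1) × (Fin (m + 1) → Fin k)
  refine ⟨Fintype.card D, fun p c hp hp1 n => ?_⟩
  let V := {v : Fin n → Fin m → Fin k // ∑ i, -Real.log (p (v i)) ≤ n * c}
  let R : X → D × V → Prop := fun x d => ∃ u ∈ Icc (0 : ℝ) m, ⌊u / δ⌋₊ = d.1.1 ∧
    (∀ j : Fin (m + 1), P (φ j x) = d.1.2 j) ∧
    ∀ (i : Fin n) (j : Fin m), P (φ j (φ (i * m + u) x)) = d.2.1 i j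
  let Z := {x | ∃ u ∈ Icc (0 : ℝ) m,
    ∑ i : Fin n, -Real.log (p fun j => P (φ j (φ (i * m + u) x))) ≤ n * c}
  have hR : ∀ x ∈ Z, ∃ d, R x d := by
    rintro x ⟨u, hu, hsum⟩
    have hfloor : ⌊u / δ⌋₊ < ⌊m / δ⌋₊ + 1 :=
      Nat.lt_succ_of_le (Nat.floor_le_floor (div_le_div_of_nonneg_right hu.2 hδ0.le))
    exact ⟨((⟨⌊u / δ⌋₊, hfloor⟩, fun j => P (φ j x)),
      ⟨fun i j => P (φ j (φ (i * m + u) x)), hsum⟩), u, hu, rfl, fun _ => rfl, fun _ _ => rfl⟩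
  have hball : ∀ x y d, R x d → R y d → y ∈ reparBall φ x (n * m) ε := by
    rintro x y d ⟨u, hu, hud, hxstart, hxname⟩ ⟨v, hv, hvd, hystart, hyname⟩
    refine mem_reparBall_of_forall_dist_lt fun s hs => ?_
    refine dist_orbit_lt hφ hP hδ (n := n * m) (v := v) hu ?_ (fun j hj => ?_)
      (fun j hj => ?_) (by exact_mod_cast hs)
    · have hu1 := Nat.floor_le (div_nonneg hu.1 hδ0.le)
      have hu2 := Nat.lt_floor_add_one (u / δ)
      have hv1 := Nat.floor_le (div_nonneg hv.1 hδ0.le)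
      have hv2 := Nat.lt_floor_add_one (v / δ)
      rw [hud] at hu1 hu2
      rw [hvd] at hv1 hv2
      rw [le_div_iff₀ hδ0] at hu1 hv1
      rw [div_lt_iff₀ hδ0] at hu2 hv2
      rw [abs_le]
      constructor <;> linarith
    · exact (hxstart ⟨j, hj⟩).trans (hystart ⟨j, hj⟩).symm
    · have hm : 0 < m := Nat.pos_of_ne_zero fun h => by simp [h] at hj
      have hi : j / m < n := (Nat.div_lt_iff_lt_mul hm).2 hj
      have h := (hxname ⟨j / m, hi⟩ ⟨j % m, Nat.mod_lt _ hm⟩).trans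
        (hyname ⟨j / m, hi⟩ ⟨j % m, Nat.mod_lt _ hm⟩).symm
      have hj' : ((j % m : ℕ) : ℝ) + (j / m : ℕ) * m = j := by
        exact_mod_cast Nat.mod_add_div' j m
      simpa only [← hφ.map_add, ← add_assoc, hj'] using h
  obtain ⟨z, hz⟩ := exists_cover_of_code Z (fun x => reparBall φ x (n * m) ε) R hR hball
  refine ⟨Fintype.card (D × V), z ∘ (Fintype.equivFin (D × V)).symm, ?_, ?_⟩
  · rw [Fintype.card_prod, Nat.cast_mul]
    have := card_words_le p hp hp1 c n
    rw [Nat.card_eq_fintype_card] at this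
    gcongr
  · refine hz.trans (iUnion_subset fun d => ?_)
    refine subset_iUnion_of_subset (Fintype.equivFin (D × V) d) ?_
    simp

/-- If the average of a continuous observable over `μ` is less than `c`, then for large `n` a
generic point has an offset in `[0, m]` along which the sampled sums are at most `n c`. -/
lemma eventually_exists_offset [TopologicalSpace X] [MeasurableSpace X] {φ : ℝ → X → X}
    (hφ : IsFlow φ) {μ : Measure X} {x : X} (hx : x ∈ genericPts φ μ) (f : C(X, ℝ)) {c : ℝ}
    (hf : ∫ y, f y ∂μ < c) {m : ℕ} (hm : 0 < m) :
    ∀ᶠ n : ℕ in atTop, ∃ u ∈ Icc (0 : ℝ) m, ∑ i : Fin n, f (φ (i * m + u) x) < n * c := by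
  have hm' : (0 : ℝ) < m := Nat.cast_pos.2 hm
  have htime : Tendsto (fun n : ℕ => (n : ℝ) * m) atTop atTop :=
    tendsto_natCast_atTop_atTop.atTop_mul_const hm'
  filter_upwards [htime.eventually ((hx f).eventually_lt_const hf), eventually_gt_atTop 0]
    with n hn hn0
  have hpos : (0 : ℝ) < n * m := mul_pos (Nat.cast_pos.2 hn0) hm'
  rw [one_div, inv_mul_lt_iff₀ hpos] at hn
  refine exists_offset (f := fun τ => f (φ τ x)) ?_ hm' hn
  exact f.continuous.comp (hφ.cont.comp (by fun_prop : Continuous fun τ : ℝ => (τ, x)))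

/-- A value above the Kolmogorov–Sinai entropy bounds the entropy per unit time of some dynamical
refinement of any finite measurable partition. -/
lemma exists_partEnt_lt [MeasurableSpace X] {μ : Measure X} {T : X → X} {h : ℝ}
    (hh : kolSinai μ T < ENNReal.ofReal h) {k : ℕ} (P : X → Fin k) (hP : Measurable P) :
    ∃ m : ℕ, 0 < m ∧ partEnt μ (fun x => fun j : Fin m => P (T^[j] x)) < m * h := by
  have hlim : Filter.limsup (fun n : ℕ =>
      ENNReal.ofReal (partEnt μ (fun x => fun j : Fin n => P (T^[(j : ℕ)] x)) / n)) atTop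
      < ENNReal.ofReal h := by
    refine lt_of_le_of_lt ?_ hh
    unfold kolSinai
    refine le_iSup_of_le k ?_
    exact le_iSup₂ (f := fun (P : X → Fin k) (_ : Measurable P) => Filter.limsup (fun n : ℕ =>
      ENNReal.ofReal (partEnt μ (fun x => fun j : Fin n => P (T^[(j : ℕ)] x)) / n)) atTop) P hP
  obtain ⟨m, hm, hm0⟩ := ((eventually_lt_of_limsup_lt hlim).and (eventually_gt_atTop 0)).exists
  refine ⟨m, hm0, ?_⟩
  have h1 := (ENNReal.ofReal_lt_ofReal_iff'.1 hm).1
  rwa [div_lt_iff₀' (Nat.cast_pos.2 hm0)] at h1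

/-- The covering sums of the generic points vanish above the Kolmogorov–Sinai entropy. -/
lemma coverMlim_genericPts_eq_zero [PseudoMetricSpace X] [CompactSpace X] [MeasurableSpace X]
    [BorelSpace X] {φ : ℝ → X → X} (hφ : IsFlow φ) {μ : Measure X} [IsProbabilityMeasure μ]
    (hinv : FlowInvariant φ μ) {h s : ℝ} (hh : kolSinai μ (φ 1) < ENNReal.ofReal h)
    (hs : h < s) : coverMlim φ (genericPts φ μ) s = 0 := by
  simp only [coverMlim, coverMeps, ENNReal.iSup_eq_zero]
  intro ε hε N
  have : Nonempty X := nonempty_of_isProbabilityMeasure μ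
  obtain ⟨η, hη, hunif⟩ := hφ.exists_dist_lt (half_pos hε)
  obtain ⟨k, P, hPmeas, hPcont, hPdiam⟩ := exists_small_partition μ hη
  obtain ⟨m, hm, hent⟩ := exists_partEnt_lt hh P hPmeas
  have hm' : (0 : ℝ) < m := Nat.cast_pos.2 hm
  simp only [hφ.iterate_one] at hent
  let Q : X → Fin m → Fin k := fun x j => P (φ j x)
  have hQmeas : Measurable Q :=
    measurable_pi_lambda _ fun j => hPmeas.comp (hinv j).measurable
  have hQcont : ∀ᵐ x ∂μ, ContinuousAt Q x := by
    have hall : ∀ᵐ x ∂μ, ∀ j : Fin m, ContinuousAt P (φ j x) :=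
      ae_all_iff.2 fun j => (hinv j).quasiMeasurePreserving.ae hPcont
    filter_upwards [hall] with x hx
    refine continuousAt_pi.2 fun j => (hx j).comp (f := φ j) ?_
    exact (hφ.cont.comp (by fun_prop : Continuous fun y : X => ((j : ℝ), y))).continuousAt
  have hQsum : ∑ w, μ.real (Q ⁻¹' {w}) = 1 := by
    rw [sum_measureReal_preimage_singleton _ fun w _ => hQmeas (measurableSet_singleton w)]
    simp
  obtain ⟨p, hp, hp1, hpent⟩ :=
    exists_pos_weights (fun w => μ.real (Q ⁻¹' {w})) (fun w => measureReal_nonneg) hQsum hent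
  obtain ⟨f, hf, hfint⟩ := exists_continuous_majorant μ Q hQcont (fun w => -Real.log (p w))
    (fun w => by
      have : p w ≤ 1 := (Finset.single_le_sum (fun v _ => (hp v).le) (Finset.mem_univ w)).trans hp1
      simpa using Real.log_nonpos (hp w).le this) hpent
  obtain ⟨K, hK⟩ := exists_reparBall_cover hφ (P := P) (ε := ε) (δ := min (η / 2) 1)
    (by positivity)
    (fun x y hxy s hs => hunif x y s ⟨by linarith [hs.1], hs.2⟩ s ⟨by linarith [hs.1], hs.2⟩
      (by simpa using hη) (hPdiam x y hxy))
    (fun r z hr => by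
      have hr1 := abs_le.1 (hr.trans (min_le_right _ _))
      have hr2 := hr.trans (min_le_left _ _)
      have := hunif z z r hr1 0 (by simp) (by rw [Real.dist_eq, sub_zero]; linarith) (by simpa)
      rwa [hφ.map_zero] at this) m
  choose L z hL hz using hK p (m * h) hp hp1
  let b : ℕ → ℝ≥0∞ := fun n => ENNReal.ofReal (K * Real.exp (n * (m * h - m * s)))
  have hb : ∑' n, b n ≠ ⊤ := by
    refine Summable.tsum_ofReal_ne_top (Summable.mul_left _ ?_)
    exact Real.summable_exp_nat_mul_iff.2 (by nlinarith)
  have hle : ∀ N', N ≤ N' → coverM φ (genericPts φ μ) s N ε ≤ ∑' n, b (n + N') := by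
    intro N' hN'
    refine (coverM_le_tsum φ _ s N ε (ι := Σ n : ℕ, Fin (L (n + N')))
      (fun i => z (i.1 + N') i.2) (fun i => ((i.1 + N' : ℕ) : ℝ) * m) ?_ ?_).trans ?_
    · intro i
      have : N ≤ (i.1 + N') * m := le_mul_of_le_of_one_le (by omega) hm
      exact_mod_cast this
    · intro x hx
      obtain ⟨n, ⟨u, hu, hsum⟩, hn⟩ :=
        ((eventually_exists_offset hφ hx f hfint hm).and (eventually_ge_atTop N')).exists
      obtain ⟨n, rfl⟩ := Nat.exists_eq_add_of_le' hn
      have hmem := hz (n + N') ⟨u, hu, (Finset.sum_le_sum fun i _ => hf _).trans hsum.le⟩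
      obtain ⟨i, hi⟩ := mem_iUnion.1 hmem
      exact mem_iUnion.2 ⟨⟨n, i⟩, hi⟩
    · rw [ENNReal.tsum_sigma fun n (_ : Fin (L (n + N'))) =>
        ENNReal.ofReal (Real.exp (-s * ((n + N' : ℕ) * m)))]
      refine ENNReal.tsum_le_tsum fun n => ?_
      rw [tsum_fintype, Finset.sum_const, Finset.card_univ, Fintype.card_fin, nsmul_eq_mul,
        ← ENNReal.ofReal_natCast, ← ENNReal.ofReal_mul (Nat.cast_nonneg _)]
      refine ENNReal.ofReal_le_ofReal ?_
      calc (L (n + N') : ℝ) * Real.exp (-s * ((n + N' : ℕ) * m))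
          ≤ K * Real.exp ((n + N' : ℕ) * (m * h)) * Real.exp (-s * ((n + N' : ℕ) * m)) := by
            gcongr
            exact hL _
        _ = K * Real.exp ((n + N' : ℕ) * (m * h - m * s)) := by
            rw [mul_assoc, ← Real.exp_add]
            ring_nf
  refine nonpos_iff_eq_zero.1 (ge_of_tendsto (ENNReal.tendsto_sum_nat_add b hb) ?_)
  filter_upwards [eventually_ge_atTop N] with N' hN' using hle N' hN'

/-- **Theorem (upper bound).** For a compact metric flow `φ` without fixed points and an
ergodic `φ`-invariant Borel probability measure `μ`,
`h_top^B(φ, G_μ(φ)) ≤ h_μ(φ₁)`. -/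
theorem bowenEntropy_genericPts_le_kolSinai {X : Type*} [MetricSpace X] [CompactSpace X]
    [MeasurableSpace X] [BorelSpace X] (φ : ℝ → X → X) (hφ : IsFlow φ)
    (hfp : FixedPointFree φ) (μ : Measure X) [IsProbabilityMeasure μ]
    (herg : FlowErgodic φ μ) :
    bowenEntropy φ (genericPts φ μ) ≤ kolSinai μ (φ 1) := by
  refine le_of_forall_gt fun a ha => ?_
  obtain ⟨s, hs0, hs1, hs2⟩ := ENNReal.lt_iff_exists_real_btwn.1 ha
  obtain ⟨h, hh0, hh1, hh2⟩ := ENNReal.lt_iff_exists_real_btwn.1 hs1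
  have hlt : h < s := (ENNReal.ofReal_lt_ofReal_iff_of_nonneg hh0).1 hh2
  refine lt_of_le_of_lt ?_ hs2
  exact iInf₂_le_of_le s hs0
    (iInf_le_of_le (coverMlim_genericPts_eq_zero hφ herg.1 hh1 hlt) le_rfl)

end FlowEntropy
end

section
/- Let (X,d) be a compact metric space, φ a continuous flow on X without fixed points, μ an ergodic φ-invariant Borel probability measure, E a Borel subset of X, and 0<s<∞. If the lower local entropy satisfies underline h_μ(φ,x) ≤ s for every x∈E, then h_top^B(φ, E) ≤ s. -/
open MeasureTheory Filter Set Topology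
open scoped ENNReal NNReal

namespace FlowEntropy

variable {X : Type*}

theorem exists_pos_no_period [MetricSpace X] [CompactSpace X] {φ : ℝ → X → X} (hφ : IsFlow φ)
    (hfp : FixedPointFree φ) : ∃ T > (0 : ℝ), ∀ c, 0 < c → c ≤ T → ∀ x, φ c x ≠ x := by
  by_contra! H
  choose c hc0 hcle x hx using fun n : ℕ => H (1 / ((n : ℝ) + 1)) (by positivity)
  obtain ⟨a, ψ, hψ, ha⟩ := CompactSpace.tendsto_subseq x
  obtain ⟨t, ht⟩ := hfp a
  apply ht
  have hc : Tendsto (fun n => c (ψ n)) atTop (𝓝 0) :=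
    (squeeze_zero (fun n => (hc0 n).le) hcle tendsto_one_div_add_atTop_nhds_zero_nat).comp
      hψ.tendsto_atTop
  let r : ℕ → ℝ := fun n => t - ⌊t / c (ψ n)⌋ • c (ψ n)
  have hr0 : ∀ n, 0 ≤ r n := fun n => by
    have := Int.floor_le (t / c (ψ n))
    rw [le_div_iff₀ (hc0 _)] at this
    simpa [r, zsmul_eq_mul] using this
  have hr1 : ∀ n, r n ≤ c (ψ n) := fun n => by
    have := (Int.lt_floor_add_one (t / c (ψ n))).le
    rw [div_le_iff₀ (hc0 _)] at this
    simp only [r, zsmul_eq_mul]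
    linarith
  have hr : Tendsto r atTop (𝓝 0) := squeeze_zero hr0 hr1 hc
  have heq : ∀ n, φ (r n) (x (ψ n)) = φ t (x (ψ n)) := fun n => by
    have hp : Function.Periodic (fun u => φ u (x (ψ n))) (c (ψ n)) := fun u => by
      change φ (u + c (ψ n)) _ = _
      rw [hφ.map_add, hx]
    exact hp.sub_zsmul_eq _
  have h1 : Tendsto (fun n => φ (r n) (x (ψ n))) atTop (𝓝 (φ 0 a)) :=
    (hφ.cont.tendsto (0, a)).comp (hr.prodMk_nhds ha)
  have h2 : Tendsto (fun n => φ t (x (ψ n))) atTop (𝓝 (φ t a)) :=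
    (hφ.cont.tendsto (t, a)).comp (tendsto_const_nhds.prodMk_nhds ha)
  simp only [heq] at h1
  rw [tendsto_nhds_unique h2 h1, hφ.map_zero]

theorem exists_pos_le_dist [MetricSpace X] [CompactSpace X] {f : X → X}
    (hf : Continuous f) (hne : ∀ x, f x ≠ x) : ∃ κ > (0 : ℝ), ∀ x, κ ≤ dist (f x) x := by
  rcases isEmpty_or_nonempty X with hX | hX
  · exact ⟨1, one_pos, fun x => (hX.false x).elim⟩
  obtain ⟨a, -, ha⟩ := isCompact_univ.exists_isMinOn univ_nonempty
    (hf.dist continuous_id).continuousOn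
  exact ⟨dist (f a) a, dist_pos.2 (hne a), fun x => ha (mem_univ x)⟩

theorem IsFlow.exists_dist_lt_of_dist_lt [MetricSpace X] [CompactSpace X] {φ : ℝ → X → X}
    (hφ : IsFlow φ) {ω : ℝ} (hω : 0 < ω) :
    ∃ ε > 0, ∀ x y, dist x y < ε → ∀ u ∈ Icc (0 : ℝ) 1, dist (φ u x) (φ u y) < ω := by
  have hu := ((isCompact_Icc (a := (0 : ℝ)) (b := 1)).prod
    (isCompact_univ (X := X))).uniformContinuousOn_of_continuous hφ.cont.continuousOn
  obtain ⟨ε, hε, H⟩ := Metric.uniformContinuousOn_iff.1 hu ω hω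
  refine ⟨ε, hε, fun x y hxy u hu => H (u, x) ⟨hu, mem_univ _⟩ (u, y) ⟨hu, mem_univ _⟩ ?_⟩
  rw [Prod.dist_eq, dist_self]
  exact max_lt hε hxy

/-- In a flow without fixed points, a reparametrization matching two orbits closely is
close to the identity over every unit time window. -/
theorem exists_repar_window_control [MetricSpace X] [CompactSpace X] {φ : ℝ → X → X}
    (hφ : IsFlow φ) {η : ℝ} (hη : 0 < η) (hne : ∀ x, φ η x ≠ x) :
    ∃ ε > 0, ∀ (x y : X) (t : ℝ) (α : ℝ → ℝ), ContinuousOn α (Icc 0 t) →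
      (∀ s ∈ Icc 0 t, dist (φ (α s) x) (φ s y) < ε) →
      ∀ a b, 0 ≤ a → a ≤ b → b ≤ t → b ≤ a + 1 → |α b - α a - (b - a)| ≤ η := by
  obtain ⟨κ, hκ, hκle⟩ := exists_pos_le_dist (hφ.cont.comp (Continuous.prodMk_right η)) hne
  obtain ⟨ε₀, hε₀, hclose⟩ := hφ.exists_dist_lt_of_dist_lt (half_pos hκ)
  refine ⟨min ε₀ (κ / 2), by positivity, fun x y t α hα hd a b ha hab hbt hb1 => ?_⟩
  by_contra! hlt
  have hcont : ContinuousOn (fun s => |α s - α a - (s - a)|) (Icc a b) := by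
    have := hα.mono (Icc_subset_Icc ha hbt)
    fun_prop
  obtain ⟨v, ⟨hav, hvb⟩, hv⟩ := intermediate_value_Icc hab hcont
    (show η ∈ Icc _ _ from ⟨by simpa using hη.le, hlt.le⟩)
  have h1 : dist (φ (v - a) (φ (α a) x)) (φ (v - a) (φ a y)) < κ / 2 :=
    hclose _ _ ((hd a ⟨ha, hab.trans hbt⟩).trans_le (min_le_left _ _)) _
      ⟨by linarith, by linarith⟩
  have h2 : dist (φ (α v) x) (φ v y) < κ / 2 :=
    (hd v ⟨ha.trans hav, hvb.trans hbt⟩).trans_le (min_le_right _ _)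
  rw [← hφ.map_add, ← hφ.map_add, sub_add_cancel] at h1
  have h3 : dist (φ (α v) x) (φ (v - a + α a) x) < κ := by
    linarith [dist_triangle_right (φ (α v) x) (φ (v - a + α a) x) (φ v y)]
  rcases (abs_eq hη.le).1 hv with hv | hv
  · have := hκle (φ (v - a + α a) x)
    simp only [Function.comp_apply, ← hφ.map_add] at this
    rw [show η + (v - a + α a) = α v by linarith] at this
    linarith
  · have := hκle (φ (α v) x)
    simp only [Function.comp_apply, ← hφ.map_add] at this
    rw [show η + α v = v - a + α a by linarith, dist_comm] at this
    linarith

theorem abs_sub_le_of_window_control {α : ℝ → ℝ} {t η : ℝ} (h0 : α 0 = 0) (hη : 0 ≤ η)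
    (hα : ∀ a b, 0 ≤ a → a ≤ b → b ≤ t → b ≤ a + 1 → |α b - α a - (b - a)| ≤ η)
    {s : ℝ} (hs0 : 0 ≤ s) (hst : s ≤ t) : |α s - s| ≤ η * (s + 1) := by
  have key : ∀ n : ℕ, ∀ s, 0 ≤ s → s ≤ t → s ≤ n → |α s - s| ≤ η * n := by
    intro n
    induction n with
    | zero =>
      intro s hs0 _ hsn
      obtain rfl : s = 0 := le_antisymm (by simpa using hsn) hs0
      simp [h0]
    | succ n ih =>
      intro s hs0 hst hsn
      push_cast at hsn ⊢
      have ha : max (s - 1) 0 ≤ s := max_le (by linarith) hs0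
      have h1 := ih (max (s - 1) 0) (le_max_right _ _) (ha.trans hst)
        (max_le (by linarith) n.cast_nonneg)
      have h2 := hα (max (s - 1) 0) s (le_max_right _ _) ha hst
        (by linarith [le_max_left (s - 1) 0])
      rw [abs_le] at h1 h2 ⊢
      constructor <;> linarith [h1.1, h1.2, h2.1, h2.2]
  exact (key ⌈s⌉₊ s hs0 hst (Nat.le_ceil s)).trans
    (mul_le_mul_of_nonneg_left (Nat.ceil_lt_add_one hs0).le hη)

theorem mem_reparBall_self [PseudoMetricSpace X] (φ : ℝ → X → X) (x : X) (t : ℝ) {ε : ℝ}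
    (hε : 0 < ε) : x ∈ reparBall φ x t ε :=
  ⟨id, ⟨continuousOn_id, injOn_id _, rfl⟩, fun s _ => by simpa using hε⟩

theorem reparBall_subset [PseudoMetricSpace X] (φ : ℝ → X → X) (x : X) {t t' ε ε' : ℝ}
    (ht : t' ≤ t) (hε : ε ≤ ε') : reparBall φ x t ε ⊆ reparBall φ x t' ε' := by
  rintro y ⟨α, ⟨hc, hi, h0⟩, hd⟩
  have hsub : Icc 0 t' ⊆ Icc 0 t := Icc_subset_Icc_right ht
  exact ⟨α, ⟨hc.mono hsub, hi.mono hsub, h0⟩, fun s hs => (hd s (hsub hs)).trans_le hε⟩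

theorem isOpen_reparBall [PseudoMetricSpace X] {φ : ℝ → X → X} (hφ : IsFlow φ) (x : X)
    (t ε : ℝ) : IsOpen (reparBall φ x t ε) := by
  rw [isOpen_iff_eventually]
  rintro y ⟨α, hα, hd⟩
  have hαc : Continuous fun s : Icc 0 t => α s := continuousOn_iff_continuous_domRestrict.1 hα.1
  have hopen : IsOpen {p : X × Icc 0 t | dist (φ (α p.2) x) (φ p.2 p.1) < ε} := by
    refine isOpen_lt (Continuous.dist ?_ ?_) continuous_const
    · exact hφ.cont.comp ((hαc.comp continuous_snd).prodMk continuous_const)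
    · exact hφ.cont.comp ((continuous_subtype_val.comp continuous_snd).prodMk continuous_fst)
  have hev := isCompact_univ.eventually_forall_of_forall_eventually (x₀ := y)
    (P := fun z (s : Icc 0 t) => dist (φ (α s) x) (φ s z) < ε)
    fun s _ => hopen.eventually_mem (hd s s.2)
  filter_upwards [hev] with z hz
  exact ⟨α, hα, fun s hs => hz ⟨s, hs⟩ (mem_univ _)⟩

/-- The centre of a reparametrization ball lies in a slightly enlarged version of every
ball which meets it. -/
theorem mem_reparBall_of_inter [PseudoMetricSpace X] {φ : ℝ → X → X} {x y z : X}
    {t η ε : ℝ} (hη : 0 ≤ η) (hη1 : 2 * η < 1) (ht : 1 ≤ t)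
    (hctrl : ∀ (x y : X) (t : ℝ) (α : ℝ → ℝ), ContinuousOn α (Icc 0 t) →
      (∀ s ∈ Icc 0 t, dist (φ (α s) x) (φ s y) < ε) →
      ∀ a b, 0 ≤ a → a ≤ b → b ≤ t → b ≤ a + 1 → |α b - α a - (b - a)| ≤ η)
    (hx : z ∈ reparBall φ x t ε) (hy : z ∈ reparBall φ y t ε) :
    x ∈ reparBall φ y ((1 - 2 * η) * t) (2 * ε) := by
  obtain ⟨α, ⟨hαc, hαi, hα0⟩, hαd⟩ := hx
  obtain ⟨β, ⟨hβc, hβi, hβ0⟩, hβd⟩ := hy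
  have ht0 : 0 ≤ t := by linarith
  have hαt := (abs_le.1 (abs_sub_le_of_window_control hα0 hη (hctrl x z t α hαc hαd)
    ht0 le_rfl)).1
  have hex : ∀ s ∈ Icc 0 ((1 - 2 * η) * t), ∃ u ∈ Icc 0 t, α u = s := fun s hs =>
    intermediate_value_Icc ht0 hαc ⟨hα0.le.trans hs.1, hs.2.trans (by nlinarith)⟩
  choose! σ hσ hασ using hex
  have hσi : InjOn σ (Icc 0 ((1 - 2 * η) * t)) := fun a ha b hb hab => by
    rw [← hασ a ha, ← hασ b hb, hab]
  have hσc : ContinuousOn σ (Icc 0 ((1 - 2 * η) * t)) := by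
    have hemb := (hαc.domRestrict.isClosedEmbedding hαi.injective).isEmbedding
    rw [continuousOn_iff_continuous_domRestrict]
    have : Continuous fun s : Icc 0 ((1 - 2 * η) * t) => (⟨σ s, hσ s s.2⟩ : Icc 0 t) := by
      rw [hemb.continuous_iff]
      exact continuous_subtype_val.congr fun s => (hασ s s.2).symm
    exact continuous_subtype_val.comp this
  have hdist : ∀ s ∈ Icc 0 ((1 - 2 * η) * t), dist (φ (β (σ s)) y) (φ s x) < 2 * ε := by
    intro s hs
    have h1 := hαd _ (hσ s hs)
    have h2 := hβd _ (hσ s hs)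
    rw [hασ s hs] at h1
    linarith [dist_triangle_right (φ (β (σ s)) y) (φ s x) (φ (σ s) z)]
  have h0 : (0 : ℝ) ∈ Icc 0 ((1 - 2 * η) * t) :=
    ⟨le_rfl, mul_nonneg (by linarith) ht0⟩
  have hσ0 : σ 0 = 0 := hαi (hσ 0 h0) ⟨le_rfl, ht0⟩ ((hασ 0 h0).trans hα0.symm)
  exact ⟨β ∘ σ, ⟨hβc.comp hσc hσ, hβi.comp hσi hσ, by rw [Function.comp_apply, hσ0, hβ0]⟩,
    hdist⟩

theorem exp_le_of_localRate_lt [PseudoMetricSpace X] [MeasurableSpace X] {μ : Measure X}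
    [IsProbabilityMeasure μ] {φ : ℝ → X → X} {x : X} {ε t s : ℝ} (ht : 0 < t)
    (h : localRate μ φ x ε t < ENNReal.ofReal s) :
    ENNReal.ofReal (Real.exp (-s * t)) ≤ μ (reparBall φ x t ε) := by
  unfold localRate negLogNN at h
  split_ifs at h with h0
  · rw [ENNReal.top_div_of_ne_top ENNReal.ofReal_ne_top] at h
    exact absurd h not_top_lt
  · have hfin : μ (reparBall φ x t ε) ≠ ⊤ := measure_ne_top _ _
    have hpos := ENNReal.toReal_pos h0 hfin
    rw [← ENNReal.ofReal_div_of_pos ht] at h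
    have h1 := (ENNReal.ofReal_lt_ofReal_iff'.1 h).1
    rw [div_lt_iff₀ ht] at h1
    rw [ENNReal.ofReal_le_iff_le_toReal hfin, ← Real.le_log_iff_exp_le hpos]
    linarith

theorem exists_cover_sum_le [MetricSpace X] [CompactSpace X] [MeasurableSpace X] [BorelSpace X]
    {φ : ℝ → X → X} (hφ : IsFlow φ) {μ : Measure X} [IsProbabilityMeasure μ] {E : Set X}
    {s ε η : ℝ} (hε : 0 < ε) (hη : 0 ≤ η) (hη1 : 2 * η < 1)
    (hctrl : ∀ (x y : X) (t : ℝ) (α : ℝ → ℝ), ContinuousOn α (Icc 0 t) →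
      (∀ s ∈ Icc 0 t, dist (φ (α s) x) (φ s y) < ε) →
      ∀ a b, 0 ≤ a → a ≤ b → b ≤ t → b ≤ a + 1 → |α b - α a - (b - a)| ≤ η)
    {N : ℝ} (hN : 2 ≤ N)
    (hE : ∀ x ∈ E, ∃ t ≥ N, ENNReal.ofReal (Real.exp (-s * t)) ≤ μ (reparBall φ x t ε)) :
    ∃ u : Set (X × ℝ), u.Countable ∧ (∀ p ∈ u, N ≤ p.2) ∧
      (E ⊆ ⋃ p ∈ u, reparBall φ p.1 ((1 - 2 * η) * (p.2 - 1)) (2 * ε)) ∧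
      ∑' p : u, ENNReal.ofReal (Real.exp (-s * (p : X × ℝ).2)) ≤ 1 := by
  let B : X × ℝ → Set X := fun p => reparBall φ p.1 p.2 ε
  let T : Set (X × ℝ) := {p | N ≤ p.2 ∧ ENNReal.ofReal (Real.exp (-s * p.2)) ≤ μ (B p)}
  obtain ⟨u, huT, hdisj, hcov⟩ := Vitali.exists_disjoint_subfamily_covering_enlargement B T
    (fun p => Real.exp (-p.2)) (Real.exp 1) (Real.one_lt_exp_iff.2 one_pos)
    (fun p _ => (Real.exp_pos _).le) 1
    (fun p hp => Real.exp_le_one_iff.2 (by linarith [hp.1]))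
    (fun p _ => ⟨p.1, mem_reparBall_self φ p.1 p.2 hε⟩)
  have hcount : u.Countable := hdisj.countable_of_isOpen
    (fun p _ => isOpen_reparBall hφ _ _ _) (fun p _ => ⟨p.1, mem_reparBall_self φ p.1 p.2 hε⟩)
  refine ⟨u, hcount, fun p hp => (huT hp).1, fun x hx => ?_, ?_⟩
  · obtain ⟨t, htN, ht⟩ := hE x hx
    obtain ⟨⟨y, r⟩, hyu, ⟨z, hzx, hzy⟩, hr⟩ := hcov (x, t) ⟨htN, ht⟩
    rw [← Real.exp_add, Real.exp_le_exp] at hr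
    have hrN := (huT hyu).1
    simp only at hr hrN
    exact mem_biUnion hyu (mem_reparBall_of_inter hη hη1 (by linarith) hctrl
      (reparBall_subset φ x (by linarith) le_rfl hzx)
      (reparBall_subset φ y (by linarith) le_rfl hzy))
  · calc _ ≤ ∑' p : u, μ (B p) := ENNReal.tsum_le_tsum fun p => (huT p.2).2
      _ = μ (⋃ p ∈ u, B p) :=
        (measure_biUnion hcount hdisj fun p _ => (isOpen_reparBall hφ _ _ _).measurableSet).symm
      _ ≤ 1 := prob_le_one

theorem coverMlim_eq_zero [MetricSpace X] [CompactSpace X] [MeasurableSpace X] [BorelSpace X]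
    {φ : ℝ → X → X} (hφ : IsFlow φ) (hfp : FixedPointFree φ) {μ : Measure X}
    [IsProbabilityMeasure μ] {E : Set X} {s r : ℝ} (hs : 0 < s) (hsr : s < r)
    (h : ∀ x ∈ E, lowerLocalEnt μ φ x ≤ ENNReal.ofReal s) : coverMlim φ E r = 0 := by
  have hr : 0 < r := hs.trans hsr
  simp only [coverMlim, coverMeps, ENNReal.iSup_eq_zero]
  intro ε₀ hε₀ N
  obtain ⟨T, hT, hper⟩ := exists_pos_no_period hφ hfp
  obtain ⟨η, hη, hηT, hη4, hηr⟩ : ∃ η > 0, η ≤ T ∧ η ≤ 1 / 4 ∧ r * (2 * η) ≤ (r - s) / 4 := by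
    have hrs : 0 < r - s := by linarith
    refine ⟨min T (min (1 / 4) ((r - s) / (8 * r))), by positivity, min_le_left _ _,
      (min_le_right _ _).trans (min_le_left _ _), ?_⟩
    have : min T (min (1 / 4) ((r - s) / (8 * r))) ≤ (r - s) / (8 * r) :=
      (min_le_right _ _).trans (min_le_right _ _)
    rw [le_div_iff₀ (by positivity)] at this
    linarith
  obtain ⟨ε₁, hε₁, hctrl₁⟩ := exists_repar_window_control hφ hη (hper η hη hηT)
  set ε := min ε₁ (ε₀ / 2) with hεdef
  have hε : 0 < ε := by positivity
  have hctrl : ∀ (x y : X) (t : ℝ) (α : ℝ → ℝ), ContinuousOn α (Icc 0 t) →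
      (∀ s ∈ Icc 0 t, dist (φ (α s) x) (φ s y) < ε) →
      ∀ a b, 0 ≤ a → a ≤ b → b ≤ t → b ≤ a + 1 → |α b - α a - (b - a)| ≤ η :=
    fun x y t α hα hd => hctrl₁ x y t α hα fun v hv => (hd v hv).trans_le (min_le_left _ _)
  have h2ε : 2 * ε ≤ ε₀ := by linarith [min_le_right ε₁ (ε₀ / 2)]
  have hE : ∀ M : ℝ, 0 < M → ∀ x ∈ E, ∃ t ≥ M,
      ENNReal.ofReal (Real.exp (-((r + s) / 2) * t)) ≤ μ (reparBall φ x t ε) := by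
    intro M hM x hx
    have hle : liminf (fun t : ℝ => localRate μ φ x ε t) atTop ≤ ENNReal.ofReal s :=
      (le_iSup₂ (f := fun (ε : ℝ) (_ : 0 < ε) =>
        liminf (fun t : ℝ => localRate μ φ x ε t) atTop) ε hε).trans (h x hx)
    have hlt := hle.trans_lt
      ((ENNReal.ofReal_lt_ofReal_iff (by linarith)).2 (show s < (r + s) / 2 by linarith))
    obtain ⟨t, htM, ht⟩ := frequently_atTop.1
      (frequently_lt_of_liminf_lt (by isBoundedDefault) hlt) M
    exact ⟨t, htM, exp_le_of_localRate_lt (hM.trans_le htM) ht⟩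
  have hbound : ∀ M : ℝ, 2 * N + 2 ≤ M →
      coverM φ E r N ε₀ ≤ ENNReal.ofReal (Real.exp (r - (r - s) / 4 * M)) := by
    intro M hM
    have hN0 : (0 : ℝ) ≤ N := N.cast_nonneg
    obtain ⟨u, huc, huM, hcov, hsum⟩ := exists_cover_sum_le hφ hε hη.le (by linarith) hctrl
      (show 2 ≤ M by linarith) (hE M (by linarith))
    let g : X × ℝ → X × ℝ := fun p => (p.1, (1 - 2 * η) * (p.2 - 1))
    have hg : Function.Injective g := by
      rintro ⟨x, a⟩ ⟨y, b⟩ hab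
      simp only [g, Prod.mk.injEq] at hab
      have := mul_left_cancel₀ (by linarith) hab.2
      exact Prod.ext hab.1 (by simpa using this)
    have hFN : ∀ p ∈ g '' u, (N : ℝ) ≤ p.2 := by
      rintro _ ⟨p, hp, rfl⟩
      have := huM p hp
      simp only [g]
      nlinarith
    have hFE : E ⊆ ⋃ p ∈ g '' u, reparBall φ p.1 p.2 ε₀ := by
      rw [biUnion_image]
      exact hcov.trans (iUnion₂_mono fun p _ => reparBall_subset φ _ le_rfl h2ε)
    refine (iInf₂_le_of_le (g '' u) (huc.image g) (iInf₂_le hFN hFE)).trans ?_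
    rw [tsum_image (fun p : X × ℝ => ENNReal.ofReal (Real.exp (-r * p.2))) hg.injOn]
    calc ∑' p : u, ENNReal.ofReal (Real.exp (-r * (g p).2))
        ≤ ∑' p : u, ENNReal.ofReal (Real.exp (r - (r - s) / 4 * M)) *
            ENNReal.ofReal (Real.exp (-((r + s) / 2) * (p : X × ℝ).2)) := by
          refine ENNReal.tsum_le_tsum fun p => ?_
          rw [← ENNReal.ofReal_mul (Real.exp_pos _).le, ← Real.exp_add]
          refine ENNReal.ofReal_le_ofReal (Real.exp_le_exp.2 ?_)
          have hp := huM p p.2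
          simp only [g]
          nlinarith [mul_le_mul_of_nonneg_right hηr (show 0 ≤ (p : X × ℝ).2 by linarith),
            mul_le_mul_of_nonneg_left hp (show 0 ≤ (r - s) / 4 by linarith), mul_pos hr hη]
      _ ≤ ENNReal.ofReal (Real.exp (r - (r - s) / 4 * M)) := by
          rw [ENNReal.tsum_mul_left]
          exact mul_le_of_le_one_right' hsum
  have hlim : Tendsto (fun M : ℝ => ENNReal.ofReal (Real.exp (r - (r - s) / 4 * M))) atTop
      (𝓝 0) := by
    rw [← ENNReal.ofReal_zero]
    refine ENNReal.tendsto_ofReal (Real.tendsto_exp_atBot.comp ?_)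
    exact tendsto_atBot_add_const_left _ r (tendsto_neg_atTop_atBot.comp
      (tendsto_id.const_mul_atTop (show 0 < (r - s) / 4 by linarith)))
  exact le_antisymm (ge_of_tendsto hlim (eventually_atTop.2 ⟨_, hbound⟩)) zero_le

/-- **Billingsley-type theorem, upper bound.** If the lower local entropy of `μ` is at
most `s` at every point of a Borel set `E`, then `h_top^B(φ, E) ≤ s`. -/
theorem bowenEntropy_le_of_lowerLocalEnt_le {X : Type*} [MetricSpace X] [CompactSpace X]
    [MeasurableSpace X] [BorelSpace X] (φ : ℝ → X → X) (hφ : IsFlow φ)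
    (hfp : FixedPointFree φ) (μ : Measure X) [IsProbabilityMeasure μ]
    (herg : FlowErgodic φ μ) (E : Set X) (hE : MeasurableSet E) (s : ℝ) (hs : 0 < s)
    (h : ∀ x ∈ E, lowerLocalEnt μ φ x ≤ ENNReal.ofReal s) :
    bowenEntropy φ E ≤ ENNReal.ofReal s := by
  refine le_of_forall_gt_imp_ge_of_dense fun c hc => ?_
  obtain ⟨r, hr0, hsr, hrc⟩ := ENNReal.lt_iff_exists_real_btwn.1 hc
  have hsr' := (ENNReal.ofReal_lt_ofReal_iff'.1 hsr).1
  exact (iInf₂_le_of_le r hr0 (iInf_le _ (coverMlim_eq_zero hφ hfp hs hsr' h))).trans hrc.le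

end FlowEntropy
end
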